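/- arXiv:1608.04707 — 2 statements merged into one kernel-verified Lean document; each statement's English description precedes it below -/
import Mathlib

section
/- Let Ψ : ℝ³ → ℍ be twice continuously differentiable. Then for every x ∈ ℝ³ with x ≠ 0 and all indices i, j ∈ {1,2,3}: (∇ᵢ(∇ⱼΨ))(x) − (∇ⱼ(∇ᵢΨ))(x) = −(1/2) Σₖ ε_{ijk} (xᵏ/|x|³) · ĵ(x) · Ψ(x), the products being quaternion multiplication. -/
noncomputable section
open scoped Quaternion
open MeasureTheory

abbrev R3 : Type := EuclideanSpace ℝ (Fin 3)

/-- Levi-Civita symbol on `Fin 3`. -/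
def eps (i j k : Fin 3) : ℝ :=
  (((j : ℕ) : ℝ) - ((i : ℕ) : ℝ)) * (((k : ℕ) : ℝ) - ((i : ℕ) : ℝ)) *
    (((k : ℕ) : ℝ) - ((j : ℕ) : ℝ)) / 2

/-- The quaternionic imaginary units 𝔢₁, 𝔢₂, 𝔢₃. -/
def qe : Fin 3 → ℍ[ℝ] := ![⟨0,1,0,0⟩, ⟨0,0,1,0⟩, ⟨0,0,0,1⟩]

/-- ĵ(z) = (Σₖ zᵏ 𝔢ₖ)/|z|. -/
def jhat (z : R3) : ℍ[ℝ] := ‖z‖⁻¹ • ∑ k, z k • qe k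

/-- Partial derivative ∂ᵢ of a quaternion-valued function. -/
def pderiv (i : Fin 3) (Ψ : R3 → ℍ[ℝ]) (x : R3) : ℍ[ℝ] :=
  fderiv ℝ Ψ x (EuclideanSpace.single i 1)

/-- Covariant derivative ∇ᵢ. -/
def cov (i : Fin 3) (Ψ : R3 → ℍ[ℝ]) (x : R3) : ℍ[ℝ] :=
  pderiv i Ψ x + (1/2 : ℝ) • ∑ j, ∑ k, (eps i j k * x j / ‖x‖^2) • (qe k * Ψ x)

@[simp] lemma qe_0_re : (qe 0).re = 0 := rfl
@[simp] lemma qe_0_imI : (qe 0).imI = 1 := rfl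
@[simp] lemma qe_0_imJ : (qe 0).imJ = 0 := rfl
@[simp] lemma qe_0_imK : (qe 0).imK = 0 := rfl
@[simp] lemma qe_1_re : (qe 1).re = 0 := rfl
@[simp] lemma qe_1_imI : (qe 1).imI = 0 := rfl
@[simp] lemma qe_1_imJ : (qe 1).imJ = 1 := rfl
@[simp] lemma qe_1_imK : (qe 1).imK = 0 := rfl
@[simp] lemma qe_2_re : (qe 2).re = 0 := rfl
@[simp] lemma qe_2_imI : (qe 2).imI = 0 := rfl
@[simp] lemma qe_2_imJ : (qe 2).imJ = 0 := rfl
@[simp] lemma qe_2_imK : (qe 2).imK = 1 := rfl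

/-- The connection form: `cov i Ψ = ∂ᵢΨ + connForm i * Ψ`. -/
def connForm (i : Fin 3) (x : R3) : ℍ[ℝ] :=
  (‖x‖ ^ 2)⁻¹ • ∑ j, ∑ k, (eps i j k / 2 * x j) • qe k

lemma cov_eq (i : Fin 3) (Ψ : R3 → ℍ[ℝ]) (x : R3) :
    cov i Ψ x = pderiv i Ψ x + connForm i x * Ψ x := by
  simp only [cov, connForm, Finset.smul_sum, Finset.sum_mul, smul_smul, smul_mul_assoc]
  congr 1
  refine Finset.sum_congr rfl fun j _ => Finset.sum_congr rfl fun k _ => ?_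
  congr 1
  ring

lemma hasFDerivAt_coord (k : Fin 3) (x : R3) :
    HasFDerivAt (fun y : R3 => y k) (EuclideanSpace.proj k : R3 →L[ℝ] ℝ) x :=
  (EuclideanSpace.proj k : R3 →L[ℝ] ℝ).hasFDerivAt

lemma hasFDerivAt_connForm (i : Fin 3) {x : R3} (hx : x ≠ 0) :
    HasFDerivAt (connForm i)
      ((‖x‖ ^ 2)⁻¹ • (∑ j, ∑ k,
          ((eps i j k / 2) • (EuclideanSpace.proj j : R3 →L[ℝ] ℝ)).smulRight (qe k)) +
        ((-((‖x‖ ^ 2) ^ 2)⁻¹) • (2 • innerSL ℝ x)).smulRight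
          (∑ j, ∑ k, (eps i j k / 2 * x j) • qe k)) x := by
  have hn : ‖x‖ ^ 2 ≠ 0 := pow_ne_zero 2 (norm_ne_zero_iff.mpr hx)
  have hinv : HasFDerivAt (fun y : R3 => (‖y‖ ^ 2)⁻¹)
      ((-((‖x‖ ^ 2) ^ 2)⁻¹) • (2 • innerSL ℝ x)) x :=
    (hasDerivAt_inv hn).comp_hasFDerivAt x (hasStrictFDerivAt_norm_sq x).hasFDerivAt
  exact hinv.smul (HasFDerivAt.fun_sum fun j _ => HasFDerivAt.fun_sum fun k _ =>
    ((hasFDerivAt_coord j x).const_mul (eps i j k / 2)).smul_const (qe k))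

lemma pderiv_connForm (i j : Fin 3) {x : R3} (hx : x ≠ 0) :
    pderiv i (connForm j) x =
      (‖x‖ ^ 2)⁻¹ • (∑ k, (eps j i k / 2) • qe k) -
        (2 * x i / (‖x‖ ^ 2) ^ 2) • ∑ l, ∑ k, (eps j l k / 2 * x l) • qe k := by
  rw [pderiv, (hasFDerivAt_connForm j hx).fderiv, sub_eq_add_neg, ← neg_smul]
  simp only [add_apply, smul_apply,
    sum_apply, ContinuousLinearMap.smulRight_apply]
  congr 1
  · congr 1
    rw [Finset.sum_eq_single i]
    · simp
    · intro l _ hl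
      simp [hl]
    · simp
  · congr 1
    simp [EuclideanSpace.inner_single_right]
    ring

set_option maxHeartbeats 2000000 in
/-- The curvature of the connection form. -/
lemma curvature_connForm {x : R3} (hx : x ≠ 0) (i j : Fin 3) :
    pderiv i (connForm j) x - pderiv j (connForm i) x +
        (connForm i x * connForm j x - connForm j x * connForm i x) =
      -(1/2 : ℝ) • ∑ k, (eps i j k * x k / ‖x‖^3) • jhat x := by
  have hn : ‖x‖ ≠ 0 := norm_ne_zero_iff.mpr hx
  have hs : ‖x‖ ^ 2 = x 0 ^ 2 + x 1 ^ 2 + x 2 ^ 2 := by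
    simp [EuclideanSpace.norm_sq_eq, Fin.sum_univ_three]
  have hs0 : x 0 ^ 2 + x 1 ^ 2 + x 2 ^ 2 ≠ 0 := hs ▸ pow_ne_zero 2 hn
  have hpow : ∀ a : ℝ, a / ‖x‖ ^ 3 * ‖x‖⁻¹ = a / (‖x‖ ^ 2) ^ 2 := fun a => by
    field_simp
  simp only [pderiv_connForm _ _ hx, connForm, jhat, smul_smul, hpow, hs]
  fin_cases i <;> fin_cases j <;> ext <;>
    simp [Fin.sum_univ_three, eps] <;> field_simp <;> ring

lemma pderiv_cov (i j : Fin 3) {Ψ : R3 → ℍ[ℝ]} (hΨ : ContDiff ℝ 2 Ψ) {x : R3} (hx : x ≠ 0) :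
    pderiv i (cov j Ψ) x =
      fderiv ℝ (fderiv ℝ Ψ) x (EuclideanSpace.single i 1) (EuclideanSpace.single j 1) +
        (connForm j x * pderiv i Ψ x + pderiv i (connForm j) x * Ψ x) := by
  have hd : HasFDerivAt (fderiv ℝ Ψ) (fderiv ℝ (fderiv ℝ Ψ) x) x :=
    ((hΨ.fderiv_right (m := 1) (by norm_num)).differentiable (by norm_num) x).hasFDerivAt
  have hΨx : HasFDerivAt Ψ (fderiv ℝ Ψ x) x :=
    (hΨ.differentiable (by norm_num) x).hasFDerivAt
  have hA := (hasFDerivAt_connForm j hx).differentiableAt.hasFDerivAt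
  have h := (hd.clm_apply (hasFDerivAt_const (EuclideanSpace.single j (1 : ℝ)) x)).add
    (hA.mul' hΨx)
  have hc : cov j Ψ = fun y => fderiv ℝ Ψ y (EuclideanSpace.single j 1) + connForm j y * Ψ y :=
    funext fun y => cov_eq j Ψ y
  rw [pderiv, hc]
  erw [h.fderiv]
  simp [pderiv]

/-- curvature of the covariant derivatives
`∇ᵢ∇ⱼ − ∇ⱼ∇ᵢ = −(1/2) Σₖ ε_{ijk} (xᵏ/|x|³) ĵ(x)` acting on a C² function `Ψ`. -/
theorem stmt0 (Ψ : R3 → ℍ[ℝ]) (hΨ : ContDiff ℝ 2 Ψ) (x : R3) (hx : x ≠ 0) (i j : Fin 3) :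
    cov i (fun y => cov j Ψ y) x - cov j (fun y => cov i Ψ y) x =
      -(1/2 : ℝ) • ∑ k, (eps i j k * x k / ‖x‖^3) • (jhat x * Ψ x) := by
  have hsymm : fderiv ℝ (fderiv ℝ Ψ) x (EuclideanSpace.single i 1) (EuclideanSpace.single j 1) =
      fderiv ℝ (fderiv ℝ Ψ) x (EuclideanSpace.single j 1) (EuclideanSpace.single i 1) :=
    (hΨ.contDiffAt.isSymmSndFDerivAt (by simp)).eq _ _
  have hcurv := congrArg (· * Ψ x) (curvature_connForm hx i j)
  simp only [smul_mul_assoc, Finset.sum_mul] at hcurv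
  rw [← hcurv, cov_eq i, cov_eq j (fun y => cov i Ψ y), pderiv_cov i j hΨ hx,
    pderiv_cov j i hΨ hx, cov_eq, cov_eq, hsymm]
  noncomm_ring
end
end

section
/- Let Ψ : ℝ³ → ℍ be three times continuously differentiable, u, u' ∈ ℝ³, and write D_u = Σᵢ uⁱ∇ᵢ. Set b_{ij}(x) = Σₖ ε_{ijk} xᵏ/|x|³. Then for every x ∈ ℝ³ with x ≠ 0: (i) [D_u,[D_u,D_{u'}]]Ψ(x) = −(1/2)·ĵ(x)·( Σ_{i,j,l} uⁱ u'ʲ uˡ (∂b_{ij}/∂xˡ)(x) )·Ψ(x); (ii) [D_{u'},[D_u,D_{u'}]]Ψ(x) = −(1/2)·ĵ(x)·( Σ_{i,j,l} uⁱ u'ʲ u'ˡ (∂b_{ij}/∂xˡ)(x) )·Ψ(x), where [A,B]Ψ = A(BΨ) − B(AΨ). (These are the nested commutators giving the Zassenhaus term C₃ for the twisted translations.) -/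
noncomputable section
open scoped Quaternion
open MeasureTheory

/-- The directional covariant derivative `D_u = Σᵢ uⁱ ∇ᵢ`. -/
def Dop (u : R3) (Ψ : R3 → ℍ[ℝ]) (x : R3) : ℍ[ℝ] := ∑ i, u i • cov i Ψ x

/-- The matrix `b_{ij}(x) = Σₖ ε_{ijk} xᵏ/|x|³`. -/
def bfun (i j : Fin 3) (x : R3) : ℝ := ∑ k, eps i j k * x k / ‖x‖^3

/-- The real-linear embedding `ℝ³ → ℍ` onto the imaginary quaternions. -/
def imQ : R3 →L[ℝ] ℍ[ℝ] := ∑ k, (EuclideanSpace.proj k : R3 →L[ℝ] ℝ).smulRight (qe k)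

/-- The connection form of `Dop`: left multiplication by `(u × x) / (2|x|²)`. -/
def conn (u x : R3) : ℍ[ℝ] :=
  (4 * ‖x‖ ^ 2)⁻¹ • (imQ u * imQ x - imQ x * imQ u)

/-- The scalar curvature density `Σ uⁱ vʲ b_{ij}`. -/
def bform (u v x : R3) : ℝ := ∑ i, ∑ j, u i * v j * bfun i j x

lemma imQ_apply (x : R3) : imQ x = x 0 • qe 0 + x 1 • qe 1 + x 2 • qe 2 := by
  simp [imQ, Fin.sum_univ_three]

@[simp] lemma re_qe (k : Fin 3) : (qe k).re = 0 := by fin_cases k <;> rfl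

@[simp] lemma imI_qe (k : Fin 3) : (qe k).imI = if k = 0 then 1 else 0 := by
  fin_cases k <;> simp [qe]

@[simp] lemma imJ_qe (k : Fin 3) : (qe k).imJ = if k = 1 then 1 else 0 := by
  fin_cases k <;> simp [qe]

@[simp] lemma imK_qe (k : Fin 3) : (qe k).imK = if k = 2 then 1 else 0 := by
  fin_cases k <;> simp [qe]

@[simp] lemma re_imQ (x : R3) : (imQ x).re = 0 := by simp [imQ_apply]

@[simp] lemma imI_imQ (x : R3) : (imQ x).imI = x 0 := by simp [imQ_apply]

@[simp] lemma imJ_imQ (x : R3) : (imQ x).imJ = x 1 := by simp [imQ_apply]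

@[simp] lemma imK_imQ (x : R3) : (imQ x).imK = x 2 := by simp [imQ_apply]

lemma norm_sq_eq_coords (x : R3) : ‖x‖ ^ 2 = x 0 ^ 2 + x 1 ^ 2 + x 2 ^ 2 := by
  simp [EuclideanSpace.norm_sq_eq, Fin.sum_univ_three]

lemma inner_eq_coords (x v : R3) : inner ℝ x v = x 0 * v 0 + x 1 * v 1 + x 2 * v 2 := by
  simp [PiLp.inner_apply, Fin.sum_univ_three]; ring

lemma coords_sq_ne_zero {x : R3} (hx : x ≠ 0) : x 0 ^ 2 + x 1 ^ 2 + x 2 ^ 2 ≠ 0 := by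
  rw [← norm_sq_eq_coords]
  exact pow_ne_zero 2 (norm_ne_zero_iff.2 hx)

lemma jhat_eq (x : R3) : jhat x = ‖x‖⁻¹ • imQ x := by
  simp [jhat, imQ]

lemma sum_single_eq (u : R3) : ∑ i, u i • (EuclideanSpace.single i 1 : R3) = u := by
  ext j
  fin_cases j <;> simp [Fin.sum_univ_three]

lemma sum_mul_map_single (L : R3 →L[ℝ] ℝ) (u : R3) :
    ∑ i, u i * L (EuclideanSpace.single i 1) = L u := by
  conv_rhs => rw [← sum_single_eq u]
  simp

lemma conn_eq (u x : R3) :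
    conn u x = (1 / 2 : ℝ) • ∑ i, u i • ∑ j, ∑ k, (eps i j k * x j / ‖x‖ ^ 2) • qe k := by
  rw [conn]
  ext <;> simp [Fin.sum_univ_three, eps, -zero_eq_mul, -mul_eq_zero] <;> ring

lemma Dop_eq (u : R3) (Ψ : R3 → ℍ[ℝ]) (x : R3) :
    Dop u Ψ x = fderiv ℝ Ψ x u + conn u x * Ψ x := by
  have h : fderiv ℝ Ψ x u = ∑ i, u i • pderiv i Ψ x := by
    conv_lhs => rw [← sum_single_eq u]
    simp [pderiv]
  rw [h, conn_eq]
  simp only [Dop, cov, smul_add, Finset.sum_add_distrib, smul_mul_assoc, Finset.sum_mul,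
    Finset.smul_sum]
  congr 1
  refine Finset.sum_congr rfl fun i _ => Finset.sum_congr rfl fun j _ =>
    Finset.sum_congr rfl fun k _ => ?_
  rw [smul_comm]

lemma Dop_congr (u : R3) {Φ Ψ : R3 → ℍ[ℝ]} {x : R3} (h : Φ =ᶠ[nhds x] Ψ) :
    Dop u Φ x = Dop u Ψ x := by
  rw [Dop_eq, Dop_eq, h.fderiv_eq, h.eq_of_nhds]

lemma contDiffAt_conn (u : R3) {x : R3} (hx : x ≠ 0) {n : WithTop ℕ∞} :
    ContDiffAt ℝ n (conn u) x := by
  have h : ContDiffAt ℝ n (fun y : R3 => 4 * ‖y‖ ^ 2) x :=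
    contDiffAt_const.mul (contDiff_norm_sq ℝ).contDiffAt
  have hq : ContDiffAt ℝ n imQ x := imQ.contDiff.contDiffAt
  exact (h.inv (by simpa using hx)).smul
    ((contDiffAt_const.mul hq).sub (hq.mul contDiffAt_const))

lemma fderiv_conn (u v : R3) {x : R3} (hx : x ≠ 0) :
    fderiv ℝ (conn u) x v = (4 * ‖x‖ ^ 2)⁻¹ • (imQ u * imQ v - imQ v * imQ u)
      - (inner ℝ x v / (2 * (‖x‖ ^ 2) ^ 2)) • (imQ u * imQ x - imQ x * imQ u) := by
  have hN : ‖x‖ ^ 2 ≠ 0 := pow_ne_zero 2 (norm_ne_zero_iff.2 hx)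
  have h1 : HasFDerivAt (fun y : R3 => ‖y‖ ^ 2) _ x := (hasStrictFDerivAt_norm_sq x).hasFDerivAt
  have h2 := (hasDerivAt_inv (mul_ne_zero four_ne_zero hN)).comp_hasFDerivAt x (h1.const_mul 4)
  have hq : HasFDerivAt imQ imQ x := imQ.hasFDerivAt
  have h3 := (hq.const_mul (imQ u)).sub (hq.mul_const' (imQ u))
  have h4 := h2.smul h3
  have h5 : HasFDerivAt (conn u) _ x := h4
  rw [h5.fderiv]
  have hc : ((4 * ‖x‖ ^ 2) ^ 2)⁻¹ * (4 * (2 * inner ℝ x v)) =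
      inner ℝ x v / (2 * (‖x‖ ^ 2) ^ 2) := by
    field_simp
    ring
  simp [hc, sub_eq_add_neg]
  abel

lemma contDiffAt_bfun (i j : Fin 3) {x : R3} (hx : x ≠ 0) {n : WithTop ℕ∞} :
    ContDiffAt ℝ n (bfun i j) x := by
  have hn : ContDiffAt ℝ n (fun y : R3 => ‖y‖ ^ 3) x := (contDiffAt_norm ℝ hx).pow 3
  unfold bfun
  refine ContDiffAt.sum fun k _ => ContDiffAt.div ?_ hn (by simpa using hx)
  exact contDiffAt_const.mul (EuclideanSpace.proj k : R3 →L[ℝ] ℝ).contDiff.contDiffAt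

lemma hasFDerivAt_bform (u v : R3) {x : R3} (hx : x ≠ 0) :
    HasFDerivAt (bform u v) (∑ i, ∑ j, (u i * v j) • fderiv ℝ (bfun i j) x) x := by
  unfold bform
  refine HasFDerivAt.fun_sum fun i _ => HasFDerivAt.fun_sum fun j _ => ?_
  exact (((contDiffAt_bfun i j hx (n := 1)).differentiableAt (by simp)).hasFDerivAt).const_mul _

lemma fderiv_bform (u v w : R3) {x : R3} (hx : x ≠ 0) :
    fderiv ℝ (bform u v) x w = ∑ i, ∑ j, ∑ l, u i * v j * w l *
      fderiv ℝ (bfun i j) x (EuclideanSpace.single l 1) := by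
  rw [(hasFDerivAt_bform u v hx).fderiv]
  simp only [sum_apply, smul_apply, smul_eq_mul]
  refine Finset.sum_congr rfl fun i _ => Finset.sum_congr rfl fun j _ => ?_
  rw [← sum_mul_map_single, Finset.mul_sum]
  exact Finset.sum_congr rfl fun l _ => by ring

lemma differentiableAt_jhat {x : R3} (hx : x ≠ 0) : DifferentiableAt ℝ jhat x := by
  rw [funext jhat_eq]
  exact ((differentiableAt_id.norm ℝ hx).inv (norm_ne_zero_iff.2 hx)).smul
    imQ.differentiableAt

/-- The section `jhat` is covariantly constant. -/
lemma fderiv_jhat (w : R3) {x : R3} (hx : x ≠ 0) :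
    fderiv ℝ jhat x w = jhat x * conn w x - conn w x * jhat x := by
  have hr : ‖x‖ ≠ 0 := norm_ne_zero_iff.2 hx
  have h0 : HasFDerivAt (fun y : R3 => ‖y‖ ^ 2) _ x := (hasStrictFDerivAt_norm_sq x).hasFDerivAt
  have h1 := h0.sqrt (pow_ne_zero 2 hr)
  simp only [Real.sqrt_sq (norm_nonneg _)] at h1
  have h2 := (hasDerivAt_inv hr).comp_hasFDerivAt x h1
  have h3 : HasFDerivAt (fun y => ‖y‖⁻¹ • imQ y) _ x := h2.smul imQ.hasFDerivAt
  rw [funext jhat_eq, h3.fderiv]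
  have hN := norm_sq_eq_coords x
  have hS := coords_sq_ne_zero hx
  have key : ‖x‖⁻¹ • imQ w - (‖x‖⁻¹ * ((‖x‖ ^ 2)⁻¹ * inner ℝ x w)) • imQ x =
      ‖x‖⁻¹ • imQ x * conn w x - conn w x * ‖x‖⁻¹ • imQ x := by
    rw [smul_mul_assoc, mul_smul_comm, ← smul_sub, mul_smul, ← smul_sub]
    congr 1
    rw [conn, inner_eq_coords, hN]
    ext <;> simp <;> field_simp <;> ring
  rw [← key]
  simp [sub_eq_add_neg]
  congr 1
  field_simp

/-- The curvature of the connection. -/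
lemma curvature_eq (u v : R3) {x : R3} (hx : x ≠ 0) :
    fderiv ℝ (conn v) x u - fderiv ℝ (conn u) x v + (conn u x * conn v x - conn v x * conn u x)
      = (-(1 / 2 : ℝ) * bform u v x) • jhat x := by
  have hr : ‖x‖ ≠ 0 := norm_ne_zero_iff.2 hx
  have hN := norm_sq_eq_coords x
  have hS := coords_sq_ne_zero hx
  have hb : (-(1 / 2 : ℝ) * bform u v x) • jhat x = (-(1 / 2 : ℝ) * ((‖x‖ ^ 2) ^ 2)⁻¹ *
      ∑ i, ∑ j, ∑ k, u i * v j * (eps i j k * x k)) • imQ x := by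
    rw [jhat_eq, smul_smul]
    congr 1
    simp only [bform, bfun, ← Finset.sum_div, ← mul_div_assoc, ← Finset.mul_sum]
    field_simp
  rw [hb, fderiv_conn _ _ hx, fderiv_conn _ _ hx, conn, conn, inner_eq_coords, inner_eq_coords, hN]
  ext <;> simp [Fin.sum_univ_three, eps] <;> field_simp <;> ring

lemma Dop_Dop (u v : R3) {Φ : R3 → ℍ[ℝ]} {x : R3} (hΦ : ContDiffAt ℝ 2 Φ x) (hx : x ≠ 0) :
    Dop u (Dop v Φ) x = fderiv ℝ (fderiv ℝ Φ) x u v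
      + (conn v x * fderiv ℝ Φ x u + fderiv ℝ (conn v) x u * Φ x)
      + conn u x * (fderiv ℝ Φ x v + conn v x * Φ x) := by
  have h1 : DifferentiableAt ℝ (fderiv ℝ Φ) x :=
    (hΦ.fderiv_right (m := 1) (by norm_num)).differentiableAt (by simp)
  have h2 : DifferentiableAt ℝ Φ x := hΦ.differentiableAt (by simp)
  have h3 : DifferentiableAt ℝ (conn v) x :=
    (contDiffAt_conn v hx (n := 1)).differentiableAt (by simp)
  have h4 : HasFDerivAt (𝕜 := ℝ) (fun y => fderiv ℝ Φ y v) _ x :=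
    h1.hasFDerivAt.clm_apply (hasFDerivAt_const v x)
  have h5 := (h4.add (h3.hasFDerivAt.mul' h2.hasFDerivAt)).congr_of_eventuallyEq
    (.of_forall (Dop_eq v Φ))
  rw [Dop_eq, h5.fderiv, Dop_eq]
  simp

lemma commutator_Dop (u v : R3) {Φ : R3 → ℍ[ℝ]} {x : R3} (hΦ : ContDiffAt ℝ 2 Φ x)
    (hx : x ≠ 0) :
    Dop u (Dop v Φ) x - Dop v (Dop u Φ) x = (-(1 / 2 : ℝ) * bform u v x) • (jhat x * Φ x) := by
  rw [Dop_Dop u v hΦ hx, Dop_Dop v u hΦ hx, ← smul_mul_assoc (-(1 / 2 : ℝ) * bform u v x), ← curvature_eq u v hx,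
    (hΦ.isSymmSndFDerivAt (by simp)) u v]
  noncomm_ring

lemma contDiffAt_Dop (u : R3) {Φ : R3 → ℍ[ℝ]} (hΦ : ContDiff ℝ 3 Φ) {x : R3} (hx : x ≠ 0) :
    ContDiffAt ℝ 2 (Dop u Φ) x := by
  rw [funext (Dop_eq u Φ)]
  exact ((hΦ.fderiv_right (m := 2) (by norm_num)).clm_apply contDiff_const).contDiffAt.add
    ((contDiffAt_conn u hx).mul (hΦ.of_le (by norm_num)).contDiffAt)

lemma nested_commutator_Dop (u v w : R3) {Ψ : R3 → ℍ[ℝ]} (hΨ : ContDiff ℝ 3 Ψ) {x : R3}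
    (hx : x ≠ 0) :
    Dop w (fun y => Dop u (Dop v Ψ) y - Dop v (Dop u Ψ) y) x
        - (Dop u (Dop v (Dop w Ψ)) x - Dop v (Dop u (Dop w Ψ)) x)
      = -(1 / 2 : ℝ) • (jhat x * (fderiv ℝ (bform u v) x w • Ψ x)) := by
  have hΨ2 : ContDiff ℝ 2 Ψ := hΨ.of_le (by norm_num)
  have hev : (fun y => Dop u (Dop v Ψ) y - Dop v (Dop u Ψ) y) =ᶠ[nhds x]
      fun y => (-(1 / 2 : ℝ) * bform u v y) • (jhat y * Ψ y) := by
    filter_upwards [isOpen_ne.mem_nhds hx] with y hy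
    exact commutator_Dop u v hΨ2.contDiffAt hy
  have hb := ((hasFDerivAt_bform u v hx).differentiableAt.hasFDerivAt).const_mul (-(1 / 2 : ℝ))
  have hd := hb.smul ((differentiableAt_jhat hx).hasFDerivAt.mul'
    (hΨ2.differentiable (by simp) x).hasFDerivAt)
  have hd' : HasFDerivAt (fun y => (-(1 / 2 : ℝ) * bform u v y) • (jhat y * Ψ y)) _ x := hd
  rw [Dop_congr w hev, commutator_Dop u v (contDiffAt_Dop w hΨ hx) hx, Dop_eq w Ψ, Dop_eq w,
    hd'.fderiv]
  simp only [add_apply, smul_apply,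
    ContinuousLinearMap.smulRight_apply, fderiv_jhat w hx, smul_eq_mul, op_smul_eq_mul,
    mul_smul_comm, smul_smul, mul_add, smul_add, smul_sub, mul_assoc]
  module

/-- the nested commutators giving the Zassenhaus term `C₃`
for the twisted translations:
`[D_u,[D_u,D_u']] = −(1/2) ĵ(x) Σ uⁱu'ʲuˡ ∂ₗb_{ij}` and
`[D_u',[D_u,D_u']] = −(1/2) ĵ(x) Σ uⁱu'ʲu'ˡ ∂ₗb_{ij}`. -/
theorem stmt12 (Ψ : R3 → ℍ[ℝ]) (hΨ : ContDiff ℝ 3 Ψ) (u u' : R3)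
    (x : R3) (hx : x ≠ 0) :
    (Dop u (fun y => Dop u (Dop u' Ψ) y - Dop u' (Dop u Ψ) y) x
        - (Dop u (Dop u' (Dop u Ψ)) x - Dop u' (Dop u (Dop u Ψ)) x)
      = -(1/2 : ℝ) • (jhat x *
          ((∑ i, ∑ j, ∑ l, u i * u' j * u l *
              fderiv ℝ (bfun i j) x (EuclideanSpace.single l 1)) • Ψ x))) ∧
    (Dop u' (fun y => Dop u (Dop u' Ψ) y - Dop u' (Dop u Ψ) y) x
        - (Dop u (Dop u' (Dop u' Ψ)) x - Dop u' (Dop u (Dop u' Ψ)) x)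
      = -(1/2 : ℝ) • (jhat x *
          ((∑ i, ∑ j, ∑ l, u i * u' j * u' l *
              fderiv ℝ (bfun i j) x (EuclideanSpace.single l 1)) • Ψ x))) := by
  rw [← fderiv_bform u u' u hx, ← fderiv_bform u u' u' hx]
  exact ⟨nested_commutator_Dop u u' u hΨ hx, nested_commutator_Dop u u' u' hΨ hx⟩
end
end
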